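/- There exists a constant C > 0 such that for all f₁, f₂ in the class below and for each choice ∂_j ∈ {∂_x, ∂_z}, the following hold: (i) ‖f₁ ∂_j f₂‖_{L²} ≤ C (‖∂_j f₁‖_{L²} + ‖f₁‖_{L²}) ‖Δ f₂‖_{L²}; (ii) ‖f₁ f₂‖_{L²} + ‖∂_j(f₁ f₂)‖_{L²} ≤ C (‖∂_j f₁‖_{L²} + ‖f₁‖_{L²}) ‖f₂‖_{H²}. The constant C is independent of f₁, f₂ and of the choice of j. -/

import Mathlib

open MeasureTheory

noncomputable section

/-- Partial derivative in the first variable `x`. -/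
def pdx (f : ℝ → ℝ → ℝ → ℂ) : ℝ → ℝ → ℝ → ℂ :=
  fun x y z => deriv (fun x' => f x' y z) x

/-- Partial derivative in the second variable `y`. -/
def pdy (f : ℝ → ℝ → ℝ → ℂ) : ℝ → ℝ → ℝ → ℂ :=
  fun x y z => deriv (fun y' => f x y' z) y

/-- Partial derivative in the third variable `z`. -/
def pdz (f : ℝ → ℝ → ℝ → ℂ) : ℝ → ℝ → ℝ → ℂ :=
  fun x y z => deriv (fun z' => f x y z') z

/-- Iterated partial derivative `∂^α` for a multi-index `α ∈ ℕ³`. -/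
def pderiv3 (α : ℕ × ℕ × ℕ) (f : ℝ → ℝ → ℝ → ℂ) : ℝ → ℝ → ℝ → ℂ :=
  (pdx^[α.1]) ((pdy^[α.2.1]) ((pdz^[α.2.2]) f))

/-- Squared `L²` norm on `Ω = 𝕋 × ℝ × 𝕋` (with periods `1` in `x` and `z`):
`‖f‖_{L²}² = ∫₀¹∫_ℝ∫₀¹ |f(x,y,z)|² dx dy dz`. -/
def L2sq (f : ℝ → ℝ → ℝ → ℂ) : ℝ :=
  ∫ x in Set.Ioc (0:ℝ) 1, ∫ y : ℝ, ∫ z in Set.Ioc (0:ℝ) 1, ‖f x y z‖ ^ 2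

/-- `L²` norm on `Ω = 𝕋 × ℝ × 𝕋`. -/
def L2norm (f : ℝ → ℝ → ℝ → ℂ) : ℝ :=
  Real.sqrt (L2sq f)

/-- The multi-indices `α ∈ ℕ³` of order `|α| ≤ N`. -/
def multiIndicesLe (N : ℕ) : Finset (ℕ × ℕ × ℕ) :=
  (Finset.range (N+1) ×ˢ Finset.range (N+1) ×ˢ Finset.range (N+1)).filter
    fun α => α.1 + α.2.1 + α.2.2 ≤ N

/-- Squared `H^N` norm: `‖f‖_{H^N}² = Σ_{|α| ≤ N} ‖∂^α f‖_{L²}²`. -/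
def HNsq (N : ℕ) (f : ℝ → ℝ → ℝ → ℂ) : ℝ :=
  ∑ α ∈ multiIndicesLe N, L2sq (pderiv3 α f)

/-- `H^N` norm. -/
def HN (N : ℕ) (f : ℝ → ℝ → ℝ → ℂ) : ℝ :=
  Real.sqrt (HNsq N f)

/-- `L²` norm of the gradient: `‖∇f‖_{L²}² = ‖∂_x f‖² + ‖∂_y f‖² + ‖∂_z f‖²`. -/
def gradL2norm (f : ℝ → ℝ → ℝ → ℂ) : ℝ :=
  Real.sqrt (L2sq (pdx f) + L2sq (pdy f) + L2sq (pdz f))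

/-- The Laplacian `Δ = ∂_x² + ∂_y² + ∂_z²`. -/
def lap (f : ℝ → ℝ → ℝ → ℂ) : ℝ → ℝ → ℝ → ℂ :=
  pdx (pdx f) + pdy (pdy f) + pdz (pdz f)

/-- The operator `∂_x² + ∂_z²`. -/
def dxxzz (f : ℝ → ℝ → ℝ → ℂ) : ℝ → ℝ → ℝ → ℂ :=
  pdx (pdx f) + pdz (pdz f)

/-- The class of smooth functions `f : ℝ³ → ℂ` which are `1`-periodic in `x` and in `z`
and, together with all partial derivatives, decay faster than any polynomial as
`|y| → ∞`. -/
structure GoodFn (f : ℝ → ℝ → ℝ → ℂ) : Prop where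
  smooth : ContDiff ℝ (⊤ : ℕ∞) (fun p : ℝ × ℝ × ℝ => f p.1 p.2.1 p.2.2)
  per_x : ∀ x y z, f (x + 1) y z = f x y z
  per_z : ∀ x y z, f x y (z + 1) = f x y z
  decay : ∀ (α : ℕ × ℕ × ℕ) (n : ℕ), ∃ C : ℝ, ∀ x y z : ℝ,
    ‖pderiv3 α f x y z‖ * |y| ^ n ≤ C

/-- The uncurried form of a function of three real variables. -/
def uncurry3 (f : ℝ → ℝ → ℝ → ℂ) : ℝ × ℝ × ℝ → ℂ := fun p => f p.1 p.2.1 p.2.2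

/-- Smoothness of a function of three real variables. -/
def Smooth3 (f : ℝ → ℝ → ℝ → ℂ) : Prop := ContDiff ℝ (⊤ : ℕ∞) (uncurry3 f)

/-- Exchange of the first and the third variable. -/
def swapXZ (f : ℝ → ℝ → ℝ → ℂ) : ℝ → ℝ → ℝ → ℂ := fun x y z => f z y x

/-- Directional derivative in a fixed direction. -/
def dirDeriv (v : ℝ × ℝ × ℝ) (f : ℝ → ℝ → ℝ → ℂ) : ℝ → ℝ → ℝ → ℂ :=
  fun x y z => fderiv ℝ (uncurry3 f) (x, y, z) v

namespace Smooth3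

variable {f : ℝ → ℝ → ℝ → ℂ}

theorem hasFDerivAt (hf : Smooth3 f) (p : ℝ × ℝ × ℝ) :
    HasFDerivAt (uncurry3 f) (fderiv ℝ (uncurry3 f) p) p :=
  (ContDiff.differentiable hf (by simp) p).hasFDerivAt

theorem hasDerivAt_x' (hf : Smooth3 f) (x y z : ℝ) :
    HasDerivAt (fun t => f t y z) (dirDeriv (1, 0, 0) f x y z) x := by
  have h : HasDerivAt (fun t : ℝ => (t, y, z)) ((1 : ℝ), (0 : ℝ), (0 : ℝ)) x :=
    (hasDerivAt_id x).prodMk ((hasDerivAt_const x y).prodMk (hasDerivAt_const x z))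
  exact (hf.hasFDerivAt (x, y, z)).comp_hasDerivAt x h

theorem hasDerivAt_y' (hf : Smooth3 f) (x y z : ℝ) :
    HasDerivAt (fun t => f x t z) (dirDeriv (0, 1, 0) f x y z) y := by
  have h : HasDerivAt (fun t : ℝ => (x, t, z)) ((0 : ℝ), (1 : ℝ), (0 : ℝ)) y :=
    (hasDerivAt_const y x).prodMk ((hasDerivAt_id y).prodMk (hasDerivAt_const y z))
  exact (hf.hasFDerivAt (x, y, z)).comp_hasDerivAt y h

theorem hasDerivAt_z' (hf : Smooth3 f) (x y z : ℝ) :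
    HasDerivAt (fun t => f x y t) (dirDeriv (0, 0, 1) f x y z) z := by
  have h : HasDerivAt (fun t : ℝ => (x, y, t)) ((0 : ℝ), (0 : ℝ), (1 : ℝ)) z :=
    (hasDerivAt_const z x).prodMk ((hasDerivAt_const z y).prodMk (hasDerivAt_id z))
  exact (hf.hasFDerivAt (x, y, z)).comp_hasDerivAt z h

theorem pdx_eq (hf : Smooth3 f) : pdx f = dirDeriv (1, 0, 0) f := by
  funext x y z; exact (hf.hasDerivAt_x' x y z).deriv

theorem pdy_eq (hf : Smooth3 f) : pdy f = dirDeriv (0, 1, 0) f := by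
  funext x y z; exact (hf.hasDerivAt_y' x y z).deriv

theorem pdz_eq (hf : Smooth3 f) : pdz f = dirDeriv (0, 0, 1) f := by
  funext x y z; exact (hf.hasDerivAt_z' x y z).deriv

theorem hasDerivAt_x (hf : Smooth3 f) (x y z : ℝ) :
    HasDerivAt (fun t => f t y z) (pdx f x y z) x := by
  rw [hf.pdx_eq]; exact hf.hasDerivAt_x' x y z

theorem hasDerivAt_y (hf : Smooth3 f) (x y z : ℝ) :
    HasDerivAt (fun t => f x t z) (pdy f x y z) y := by
  rw [hf.pdy_eq]; exact hf.hasDerivAt_y' x y z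

theorem hasDerivAt_z (hf : Smooth3 f) (x y z : ℝ) :
    HasDerivAt (fun t => f x y t) (pdz f x y z) z := by
  rw [hf.pdz_eq]; exact hf.hasDerivAt_z' x y z

protected theorem dirDeriv (hf : Smooth3 f) (v : ℝ × ℝ × ℝ) : Smooth3 (dirDeriv v f) := by
  have h : ContDiff ℝ (⊤ : ℕ∞) (fderiv ℝ (uncurry3 f)) :=
    ContDiff.fderiv_right (n := ((⊤ : ℕ∞) : WithTop ℕ∞)) hf (by simp)
  exact h.clm_apply contDiff_const

theorem dirDeriv_comm (hf : Smooth3 f) (v w : ℝ × ℝ × ℝ) :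
    dirDeriv v (dirDeriv w f) = dirDeriv w (dirDeriv v f) := by
  have h : ContDiff ℝ (⊤ : ℕ∞) (fderiv ℝ (uncurry3 f)) :=
    ContDiff.fderiv_right (n := ((⊤ : ℕ∞) : WithTop ℕ∞)) hf (by simp)
  have key : ∀ (v w p : ℝ × ℝ × ℝ), fderiv ℝ (uncurry3 (dirDeriv w f)) p v
      = fderiv ℝ (fderiv ℝ (uncurry3 f)) p v w := by
    intro v w p
    have h1 : HasFDerivAt (fderiv ℝ (uncurry3 f)) (fderiv ℝ (fderiv ℝ (uncurry3 f)) p) p :=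
      (h.differentiable (by simp) p).hasFDerivAt
    have h2 := h1.clm_apply (hasFDerivAt_const w p)
    have h3 : fderiv ℝ (uncurry3 (dirDeriv w f)) p = _ := h2.fderiv
    rw [h3]; simp
  funext x y z
  have hs : IsSymmSndFDerivAt ℝ (uncurry3 f) (x, y, z) :=
    (ContDiff.contDiffAt hf).isSymmSndFDerivAt
      (by simpa using! (WithTop.coe_le_coe.2 le_top :
        ((2 : ℕ∞) : WithTop ℕ∞) ≤ ((⊤ : ℕ∞) : WithTop ℕ∞)))
  change fderiv ℝ _ _ _ = fderiv ℝ _ _ _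
  rw [key, key]
  exact hs v w

protected theorem pdx (hf : Smooth3 f) : Smooth3 (pdx f) := hf.pdx_eq ▸ hf.dirDeriv _

protected theorem pdy (hf : Smooth3 f) : Smooth3 (pdy f) := hf.pdy_eq ▸ hf.dirDeriv _

protected theorem pdz (hf : Smooth3 f) : Smooth3 (pdz f) := hf.pdz_eq ▸ hf.dirDeriv _

theorem pdx_pdy (hf : Smooth3 f) : pdx (pdy f) = pdy (pdx f) := by
  rw [hf.pdy.pdx_eq, hf.pdy_eq, hf.pdx.pdy_eq, hf.pdx_eq, hf.dirDeriv_comm]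

theorem pdx_pdz (hf : Smooth3 f) : pdx (pdz f) = pdz (pdx f) := by
  rw [hf.pdz.pdx_eq, hf.pdz_eq, hf.pdx.pdz_eq, hf.pdx_eq, hf.dirDeriv_comm]

theorem pdy_pdz (hf : Smooth3 f) : pdy (pdz f) = pdz (pdy f) := by
  rw [hf.pdz.pdy_eq, hf.pdz_eq, hf.pdy.pdz_eq, hf.pdy_eq, hf.dirDeriv_comm]

theorem iterate {P : (ℝ → ℝ → ℝ → ℂ) → ℝ → ℝ → ℝ → ℂ} (hP : ∀ g, Smooth3 g → Smooth3 (P g))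
    (hf : Smooth3 f) (n : ℕ) : Smooth3 (P^[n] f) := by
  induction n with
  | zero => exact hf
  | succ n ih => rw [Function.iterate_succ_apply']; exact hP _ ih

theorem iterate_comm {P Q : (ℝ → ℝ → ℝ → ℂ) → ℝ → ℝ → ℝ → ℂ}
    (hP : ∀ g, Smooth3 g → Smooth3 (P g)) (hPQ : ∀ g, Smooth3 g → Q (P g) = P (Q g))
    (hf : Smooth3 f) (n : ℕ) : P^[n] (Q f) = Q (P^[n] f) := by
  induction n with
  | zero => rfl
  | succ n ih =>
    rw [Function.iterate_succ_apply', Function.iterate_succ_apply', ih,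
      hPQ _ (hf.iterate hP n)]

theorem iterate_iterate_comm {P Q : (ℝ → ℝ → ℝ → ℂ) → ℝ → ℝ → ℝ → ℂ}
    (hP : ∀ g, Smooth3 g → Smooth3 (P g)) (hQ : ∀ g, Smooth3 g → Smooth3 (Q g))
    (hPQ : ∀ g, Smooth3 g → Q (P g) = P (Q g))
    (hf : Smooth3 f) (n m : ℕ) : P^[n] (Q^[m] f) = Q^[m] (P^[n] f) := by
  induction m with
  | zero => rfl
  | succ m ih =>
    rw [Function.iterate_succ_apply', Function.iterate_succ_apply',
      iterate_comm hP hPQ (hf.iterate hQ m), ih]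

protected theorem swapXZ (hf : Smooth3 f) : Smooth3 (swapXZ f) :=
  ContDiff.comp (g := uncurry3 f) (f := fun p : ℝ × ℝ × ℝ => (p.2.2, p.2.1, p.1)) hf
    (by fun_prop)

protected theorem continuous (hf : Smooth3 f) : Continuous (uncurry3 f) := ContDiff.continuous hf

end Smooth3

namespace GoodFn

variable {f : ℝ → ℝ → ℝ → ℂ}

theorem smooth3 (hf : GoodFn f) : Smooth3 f := hf.smooth

protected theorem pdx (hf : GoodFn f) : GoodFn (pdx f) where
  smooth := hf.smooth3.pdx
  per_x x y z := by
    have : (fun t => f (t + 1) y z) = fun t => f t y z := funext fun t => hf.per_x t y z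
    simp only [pdx, ← deriv_comp_add_const (f := fun t => f t y z), this]
  per_z x y z := by simp only [pdx, hf.per_z]
  decay α n := by
    have : pderiv3 α (pdx f) = pderiv3 (α.1 + 1, α.2.1, α.2.2) f := by
      simp only [pderiv3, Function.iterate_succ_apply]
      rw [hf.smooth3.iterate_comm (fun g hg => hg.pdz) (fun g hg => hg.pdx_pdz),
        (hf.smooth3.iterate (fun g hg => hg.pdz) _).iterate_comm (fun g hg => hg.pdy)
          (fun g hg => hg.pdx_pdy)]
    rw [this]; exact hf.decay _ n

protected theorem pdy (hf : GoodFn f) : GoodFn (pdy f) where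
  smooth := hf.smooth3.pdy
  per_x x y z := by simp only [pdy, hf.per_x]
  per_z x y z := by simp only [pdy, hf.per_z]
  decay α n := by
    have : pderiv3 α (pdy f) = pderiv3 (α.1, α.2.1 + 1, α.2.2) f := by
      simp only [pderiv3, Function.iterate_succ_apply]
      rw [hf.smooth3.iterate_comm (fun g hg => hg.pdz) (fun g hg => hg.pdy_pdz)]
    rw [this]; exact hf.decay _ n

protected theorem pdz (hf : GoodFn f) : GoodFn (pdz f) where
  smooth := hf.smooth3.pdz
  per_x x y z := by simp only [pdz, hf.per_x]
  per_z x y z := by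
    have : (fun t => f x y (t + 1)) = fun t => f x y t := funext fun t => hf.per_z x y t
    simp only [pdz, ← deriv_comp_add_const (f := fun t => f x y t), this]
  decay α n := hf.decay (α.1, α.2.1, α.2.2 + 1) n

protected theorem swapXZ (hf : GoodFn f) : GoodFn (swapXZ f) where
  smooth := hf.smooth3.swapXZ
  per_x x y z := hf.per_z z y x
  per_z x y z := hf.per_x z y x
  decay α n := by
    obtain ⟨a, b, c⟩ := α
    have hx : ∀ n, Function.Semiconj swapXZ (pdx^[n]) (pdz^[n]) :=
      Function.Semiconj.iterate_right (f := swapXZ) (ga := pdx) (gb := pdz)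
        fun _ => rfl
    have hy : ∀ n, Function.Semiconj swapXZ (pdy^[n]) (pdy^[n]) :=
      Function.Semiconj.iterate_right (f := swapXZ) (ga := pdy) (gb := pdy)
        fun _ => rfl
    have hz : ∀ n, Function.Semiconj swapXZ (pdz^[n]) (pdx^[n]) :=
      Function.Semiconj.iterate_right (f := swapXZ) (ga := pdz) (gb := pdx)
        fun _ => rfl
    have hs := hf.smooth3
    have hsz := hs.iterate (fun g hg => hg.pdz) a
    have hsx := hs.iterate (fun g hg => hg.pdx) c
    have : pderiv3 (a, b, c) (swapXZ f) = swapXZ (pderiv3 (c, b, a) f) := by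
      simp only [pderiv3]
      rw [← hx, ← hy, ← hz,
        hsx.iterate_iterate_comm (fun g hg => hg.pdz) (fun g hg => hg.pdy)
          (fun g hg => hg.pdy_pdz),
        hs.iterate_iterate_comm (fun g hg => hg.pdz) (fun g hg => hg.pdx)
          (fun g hg => hg.pdx_pdz),
        hsz.iterate_iterate_comm (fun g hg => hg.pdy) (fun g hg => hg.pdx)
          (fun g hg => hg.pdx_pdy)]
    obtain ⟨C, hC⟩ := hf.decay (c, b, a) n
    exact ⟨C, fun x y z => by rw [this]; exact hC z y x⟩

end GoodFn

/-- Lebesgue measure on one period. -/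
def periodMeasure : Measure ℝ := volume.restrict (Set.Ioc (0 : ℝ) 1)

instance : IsProbabilityMeasure periodMeasure :=
  ⟨by simp [periodMeasure]⟩

/-- The measure on `ℝ³` underlying the `L²` norm. -/
def stripMeasure : Measure (ℝ × ℝ × ℝ) :=
  periodMeasure.prod ((volume : Measure ℝ).prod periodMeasure)

/-- Continuity together with quadratic decay in the second variable. -/
structure Decays {E : Type*} [NormedAddCommGroup E] (F : ℝ → ℝ → ℝ → E) : Prop where
  cont : Continuous fun p : ℝ × ℝ × ℝ => F p.1 p.2.1 p.2.2
  bound : ∃ C, ∀ x y z, ‖F x y z‖ ≤ C * (1 + y ^ 2)⁻¹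

theorem GoodFn.decays {f : ℝ → ℝ → ℝ → ℂ} (hf : GoodFn f) : Decays f where
  cont := hf.smooth3.continuous
  bound := by
    obtain ⟨A, hA⟩ := hf.decay (0, 0, 0) 0
    obtain ⟨B, hB⟩ := hf.decay (0, 0, 0) 2
    refine ⟨A + B, fun x y z => ?_⟩
    have hA := hA x y z
    have hB := hB x y z
    simp only [pderiv3, Function.iterate_zero, id, pow_zero, mul_one, sq_abs] at hA hB
    rw [← div_eq_mul_inv, le_div_iff₀ (by positivity)]
    linarith

namespace Decays

section General

variable {E : Type*} [NormedAddCommGroup E] {F G : ℝ → ℝ → ℝ → E}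

theorem of_bilinear {E₁ E₂ : Type*} [NormedAddCommGroup E₁] [NormedAddCommGroup E₂]
    {u : ℝ → ℝ → ℝ → E₁} {v : ℝ → ℝ → ℝ → E₂} (hu : Decays u) (hv : Decays v)
    (hc : Continuous fun p : ℝ × ℝ × ℝ => F p.1 p.2.1 p.2.2)
    (hF : ∀ x y z, ‖F x y z‖ ≤ ‖u x y z‖ * ‖v x y z‖) : Decays F where
  cont := hc
  bound := by
    obtain ⟨A, hA⟩ := hu.bound
    obtain ⟨B, hB⟩ := hv.bound
    refine ⟨A * B, fun x y z => (hF x y z).trans ?_⟩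
    have h1 := hA x y z
    have h2 := hB x y z
    have hy : 0 < (1 + y ^ 2)⁻¹ := by positivity
    have hy1 : (1 + y ^ 2)⁻¹ ≤ 1 := inv_le_one_of_one_le₀ (by nlinarith [sq_nonneg y])
    have hA0 : 0 ≤ A := nonneg_of_mul_nonneg_left ((norm_nonneg _).trans h1) hy
    have hB0 : 0 ≤ B := nonneg_of_mul_nonneg_left ((norm_nonneg _).trans h2) hy
    calc _ ≤ (A * (1 + y ^ 2)⁻¹) * (B * (1 + y ^ 2)⁻¹) := by gcongr
      _ = A * B * (1 + y ^ 2)⁻¹ * (1 + y ^ 2)⁻¹ := by ring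
      _ ≤ A * B * (1 + y ^ 2)⁻¹ * 1 := by gcongr
      _ = _ := mul_one _

theorem add (hF : Decays F) (hG : Decays G) :
    Decays (F + G) where
  cont := hF.cont.add hG.cont
  bound := by
    obtain ⟨A, hA⟩ := hF.bound
    obtain ⟨B, hB⟩ := hG.bound
    refine ⟨A + B, fun x y z => (norm_add_le _ _).trans ?_⟩
    rw [add_mul]
    exact add_le_add (hA x y z) (hB x y z)

theorem integrable_y (hF : Decays F) (x z : ℝ) : Integrable fun y => F x y z := by
  obtain ⟨C, hC⟩ := hF.bound
  exact (integrable_inv_one_add_sq.const_mul C).mono'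
    (hF.cont.comp (f := fun y : ℝ => (x, y, z)) (by fun_prop)).aestronglyMeasurable
    (.of_forall fun y => hC x y z)

theorem integrable_yz (hF : Decays F) (x : ℝ) :
    Integrable (fun p : ℝ × ℝ => F x p.1 p.2) ((volume : Measure ℝ).prod periodMeasure) := by
  obtain ⟨C, hC⟩ := hF.bound
  exact ((integrable_inv_one_add_sq.const_mul C).comp_fst periodMeasure).mono'
    (hF.cont.comp (f := fun p : ℝ × ℝ => (x, p)) (by fun_prop)).aestronglyMeasurable
    (.of_forall fun p => hC x p.1 p.2)

theorem integrable (hF : Decays F) :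
    Integrable (fun p : ℝ × ℝ × ℝ => F p.1 p.2.1 p.2.2) stripMeasure := by
  obtain ⟨C, hC⟩ := hF.bound
  exact (((integrable_inv_one_add_sq.const_mul C).comp_fst periodMeasure).comp_snd
    periodMeasure).mono' hF.cont.aestronglyMeasurable (.of_forall fun p => hC p.1 p.2.1 p.2.2)

theorem tendsto_atBot (hF : Decays F) (x z : ℝ) :
    Filter.Tendsto (fun y => F x y z) Filter.atBot (nhds 0) := by
  obtain ⟨C, hC⟩ := hF.bound
  refine squeeze_zero_norm (fun y => hC x y z) ?_
  have h : Filter.Tendsto (fun y : ℝ => 1 + y ^ 2) Filter.atBot Filter.atTop :=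
    Filter.tendsto_atTop_add_const_left _ _ (Filter.Tendsto.congr (fun y => sq_abs y)
      ((Filter.tendsto_pow_atTop two_ne_zero).comp Filter.tendsto_abs_atBot_atTop))
  simpa using h.inv_tendsto_atTop.const_mul C

theorem tendsto_atTop (hF : Decays F) (x z : ℝ) :
    Filter.Tendsto (fun y => F x y z) Filter.atTop (nhds 0) := by
  obtain ⟨C, hC⟩ := hF.bound
  refine squeeze_zero_norm (fun y => hC x y z) ?_
  have h : Filter.Tendsto (fun y : ℝ => 1 + y ^ 2) Filter.atTop Filter.atTop :=
    Filter.tendsto_atTop_add_const_left _ _ (Filter.tendsto_pow_atTop two_ne_zero)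
  simpa using h.inv_tendsto_atTop.const_mul C

end General

section Complex

variable {u v : ℝ → ℝ → ℝ → ℂ}

protected theorem inner (hu : Decays u) (hv : Decays v) :
    Decays fun x y z => inner ℝ (u x y z) (v x y z) :=
  of_bilinear hu hv (hu.cont.inner hv.cont) fun _ _ _ => norm_inner_le_norm _ _

theorem mul (hu : Decays u) (hv : Decays v) : Decays fun x y z => u x y z * v x y z :=
  of_bilinear hu hv (hu.cont.mul hv.cont) fun _ _ _ => norm_mul_le _ _

theorem norm_sq (hu : Decays u) : Decays fun x y z => ‖u x y z‖ ^ 2 := by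
  simpa only [real_inner_self_eq_norm_sq] using hu.inner hu

end Complex

variable {F F' : ℝ → ℝ → ℝ → ℝ}

theorem integral_eq (hF : Decays F) :
    ∫ p, F p.1 p.2.1 p.2.2 ∂stripMeasure
      = ∫ x in Set.Ioc (0 : ℝ) 1, ∫ y, ∫ z in Set.Ioc (0 : ℝ) 1, F x y z := by
  rw [stripMeasure, integral_prod _ hF.integrable]
  refine integral_congr_ae (.of_forall fun x => ?_)
  exact integral_prod _ (hF.integrable_yz x)

theorem integral_deriv_x_eq_zero (hF' : Decays F')
    (hd : ∀ x y z, HasDerivAt (fun t => F t y z) (F' x y z) x)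
    (hp : ∀ x y z, F (x + 1) y z = F x y z) :
    ∫ p, F' p.1 p.2.1 p.2.2 ∂stripMeasure = 0 := by
  rw [stripMeasure, integral_prod_symm _ hF'.integrable]
  refine integral_eq_zero_of_ae (.of_forall fun q => ?_)
  have hc : Continuous fun x => F' x q.1 q.2 :=
    hF'.cont.comp (f := fun x : ℝ => (x, q)) (by fun_prop)
  simp only [periodMeasure, Pi.zero_apply]
  rw [← intervalIntegral.integral_of_le zero_le_one,
    intervalIntegral.integral_eq_sub_of_hasDerivAt (fun x _ => hd x q.1 q.2)
      (hc.intervalIntegrable _ _)]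
  simpa [sub_eq_zero] using hp 0 q.1 q.2

theorem integral_deriv_y_eq_zero (hF : Decays F) (hF' : Decays F')
    (hd : ∀ x y z, HasDerivAt (fun t => F x t z) (F' x y z) y) :
    ∫ p, F' p.1 p.2.1 p.2.2 ∂stripMeasure = 0 := by
  rw [stripMeasure, integral_prod _ hF'.integrable]
  refine integral_eq_zero_of_ae (.of_forall fun x => ?_)
  simp only [Pi.zero_apply]
  rw [integral_prod_symm _ (hF'.integrable_yz x)]
  refine integral_eq_zero_of_ae (.of_forall fun z => ?_)
  simpa using integral_of_hasDerivAt_of_tendsto (fun y => hd x y z) (hF'.integrable_y x z)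
    (hF.tendsto_atBot x z) (hF.tendsto_atTop x z)

theorem integral_deriv_z_eq_zero (hF' : Decays F')
    (hd : ∀ x y z, HasDerivAt (fun t => F x y t) (F' x y z) z)
    (hp : ∀ x y z, F x y (z + 1) = F x y z) :
    ∫ p, F' p.1 p.2.1 p.2.2 ∂stripMeasure = 0 := by
  rw [hF'.integral_eq]
  refine integral_eq_zero_of_ae (.of_forall fun x => integral_eq_zero_of_ae (.of_forall fun y => ?_))
  have hc : Continuous fun z => F' x y z :=
    hF'.cont.comp (f := fun z : ℝ => (x, y, z)) (by fun_prop)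
  simp only [Pi.zero_apply]
  rw [← intervalIntegral.integral_of_le zero_le_one,
    intervalIntegral.integral_eq_sub_of_hasDerivAt (fun z _ => hd x y z)
      (hc.intervalIntegrable _ _)]
  simpa [sub_eq_zero] using hp x y 0

end Decays

/-- The `L²` pairing of two functions, as a real inner product. -/
def pairing (u v : ℝ → ℝ → ℝ → ℂ) : ℝ :=
  ∫ p, inner ℝ (u p.1 p.2.1 p.2.2) (v p.1 p.2.1 p.2.2) ∂stripMeasure

theorem Decays.L2sq_eq_pairing {u : ℝ → ℝ → ℝ → ℂ} (hu : Decays u) : L2sq u = pairing u u := by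
  simp only [pairing, real_inner_self_eq_norm_sq]
  exact hu.norm_sq.integral_eq.symm

theorem pairing_comm (u v : ℝ → ℝ → ℝ → ℂ) : pairing u v = pairing v u := by
  simp only [pairing, real_inner_comm]

theorem pairing_add_left {u v w : ℝ → ℝ → ℝ → ℂ} (hu : Decays u) (hv : Decays v)
    (hw : Decays w) : pairing (u + v) w = pairing u w + pairing v w := by
  simp only [pairing, Pi.add_apply, inner_add_left]
  exact integral_add (hu.inner hw).integrable (hv.inner hw).integrable

theorem pairing_add_right {u v w : ℝ → ℝ → ℝ → ℂ} (hu : Decays u) (hv : Decays v)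
    (hw : Decays w) : pairing w (u + v) = pairing w u + pairing w v := by
  rw [pairing_comm, pairing_add_left hu hv hw, pairing_comm u, pairing_comm v]

namespace GoodFn

variable {u v f : ℝ → ℝ → ℝ → ℂ}

theorem pairing_pdx (hu : GoodFn u) (hv : GoodFn v) :
    pairing u (pdx v) = -pairing (pdx u) v := by
  rw [eq_neg_iff_add_eq_zero, pairing, pairing, ← integral_add
    (hu.decays.inner hv.pdx.decays).integrable (hu.pdx.decays.inner hv.decays).integrable]
  exact ((hu.decays.inner hv.pdx.decays).add
    (hu.pdx.decays.inner hv.decays)).integral_deriv_x_eq_zero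
      (F := fun x y z => inner ℝ (u x y z) (v x y z))
      (fun x y z => (hu.smooth3.hasDerivAt_x x y z).inner ℝ (hv.smooth3.hasDerivAt_x x y z))
      (fun x y z => by simp only [hu.per_x, hv.per_x])

theorem pairing_pdy (hu : GoodFn u) (hv : GoodFn v) :
    pairing u (pdy v) = -pairing (pdy u) v := by
  rw [eq_neg_iff_add_eq_zero, pairing, pairing, ← integral_add
    (hu.decays.inner hv.pdy.decays).integrable (hu.pdy.decays.inner hv.decays).integrable]
  exact (hu.decays.inner hv.decays).integral_deriv_y_eq_zero
    ((hu.decays.inner hv.pdy.decays).add (hu.pdy.decays.inner hv.decays))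
      (fun x y z => (hu.smooth3.hasDerivAt_y x y z).inner ℝ (hv.smooth3.hasDerivAt_y x y z))

theorem pairing_pdz (hu : GoodFn u) (hv : GoodFn v) :
    pairing u (pdz v) = -pairing (pdz u) v := by
  rw [eq_neg_iff_add_eq_zero, pairing, pairing, ← integral_add
    (hu.decays.inner hv.pdz.decays).integrable (hu.pdz.decays.inner hv.decays).integrable]
  exact ((hu.decays.inner hv.pdz.decays).add
    (hu.pdz.decays.inner hv.decays)).integral_deriv_z_eq_zero
      (F := fun x y z => inner ℝ (u x y z) (v x y z))
      (fun x y z => (hu.smooth3.hasDerivAt_z x y z).inner ℝ (hv.smooth3.hasDerivAt_z x y z))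
      (fun x y z => by simp only [hu.per_z, hv.per_z])

theorem pairing_second_derivs {P Q : (ℝ → ℝ → ℝ → ℂ) → ℝ → ℝ → ℝ → ℂ}
    (hP : ∀ {g}, GoodFn g → GoodFn (P g)) (hQ : ∀ {g}, GoodFn g → GoodFn (Q g))
    (hPP : ∀ {g h}, GoodFn g → GoodFn h → pairing g (P h) = -pairing (P g) h)
    (hQQ : ∀ {g h}, GoodFn g → GoodFn h → pairing g (Q h) = -pairing (Q g) h)
    (hPQ : ∀ {g}, GoodFn g → P (Q g) = Q (P g)) (hf : GoodFn f) :
    pairing (P (P f)) (Q (Q f)) = L2sq (P (Q f)) := by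
  rw [(hP (hQ hf)).decays.L2sq_eq_pairing, hQQ (hP (hP hf)) (hQ hf), ← hPQ (hP hf), ← hPQ hf,
    pairing_comm, hPP (hQ hf) (hP (hQ hf)), neg_neg]

theorem lap_decays (hf : GoodFn f) : Decays (lap f) :=
  (hf.pdx.pdx.decays.add hf.pdy.pdy.decays).add hf.pdz.pdz.decays

theorem L2sq_lap (hf : GoodFn f) :
    L2sq (lap f) = L2sq (pdx (pdx f)) + L2sq (pdy (pdy f))
      + L2sq (pdz (pdz f)) + 2 * L2sq (pdx (pdy f))
      + 2 * L2sq (pdx (pdz f)) + 2 * L2sq (pdy (pdz f)) := by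
  have hx := hf.pdx.pdx.decays
  have hy := hf.pdy.pdy.decays
  have hz := hf.pdz.pdz.decays
  have hxy : Decays (pdx (pdx f) + pdy (pdy f)) := hx.add hy
  have e1 := pairing_second_derivs GoodFn.pdx GoodFn.pdy pairing_pdx pairing_pdy
    (fun hg => hg.smooth3.pdx_pdy) hf
  have e2 := pairing_second_derivs GoodFn.pdx GoodFn.pdz pairing_pdx pairing_pdz
    (fun hg => hg.smooth3.pdx_pdz) hf
  have e3 := pairing_second_derivs GoodFn.pdy GoodFn.pdz pairing_pdy pairing_pdz
    (fun hg => hg.smooth3.pdy_pdz) hf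
  rw [hf.lap_decays.L2sq_eq_pairing, lap, pairing_add_left hxy hz (hxy.add hz),
    pairing_add_left hx hy (hxy.add hz), pairing_add_right hxy hz hx, pairing_add_right hxy hz hy,
    pairing_add_right hxy hz hz, pairing_add_right hx hy hx, pairing_add_right hx hy hy,
    pairing_add_right hx hy hz, pairing_comm (pdy (pdy f)) (pdx _),
    pairing_comm (pdz (pdz f)) (pdx _),
    pairing_comm (pdz (pdz f)) (pdy _), e1, e2, e3,
    ← hx.L2sq_eq_pairing, ← hy.L2sq_eq_pairing, ← hz.L2sq_eq_pairing]
  ring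

end GoodFn

open scoped ENNReal

theorem lintegral_stripMeasure {G : ℝ → ℝ → ℝ → ℝ≥0∞}
    (hG : Measurable fun p : ℝ × ℝ × ℝ => G p.1 p.2.1 p.2.2) :
    ∫⁻ p, G p.1 p.2.1 p.2.2 ∂stripMeasure
      = ∫⁻ x, ∫⁻ y, ∫⁻ z, G x y z ∂periodMeasure ∂volume ∂periodMeasure := by
  rw [stripMeasure, lintegral_prod _ hG.aemeasurable]
  refine lintegral_congr fun x => ?_
  exact lintegral_prod _ (hG.comp (f := fun q : ℝ × ℝ => (x, q)) (by fun_prop)).aemeasurable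

theorem lintegral_stripMeasure_symm {G : ℝ → ℝ → ℝ → ℝ≥0∞}
    (hG : Measurable fun p : ℝ × ℝ × ℝ => G p.1 p.2.1 p.2.2) :
    ∫⁻ p, G p.1 p.2.1 p.2.2 ∂stripMeasure
      = ∫⁻ z, ∫⁻ y, ∫⁻ x, G x y z ∂periodMeasure ∂volume ∂periodMeasure := by
  rw [stripMeasure, lintegral_prod_symm _ hG.aemeasurable,
    lintegral_prod_symm _ hG.lintegral_prod_left'.aemeasurable]

/-- The squared `L²` norm along the circle in the variable `x`. -/
def sliceEnergy (f : ℝ → ℝ → ℝ → ℂ) (y z : ℝ) : ℝ≥0∞ := ∫⁻ x, ‖f x y z‖ₑ ^ 2 ∂periodMeasure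

/-- The squared `L²` norm, as an extended nonnegative real. -/
def energy (f : ℝ → ℝ → ℝ → ℂ) : ℝ≥0∞ := ∫⁻ z, ∫⁻ y, sliceEnergy f y z ∂volume ∂periodMeasure

section Energy

variable {f g : ℝ → ℝ → ℝ → ℂ}

theorem Continuous.measurable_enorm_sq (hf : Continuous (uncurry3 f)) :
    Measurable fun p : ℝ × ℝ × ℝ => ‖f p.1 p.2.1 p.2.2‖ₑ ^ 2 :=
  hf.measurable.enorm.pow_const 2

theorem Continuous.measurable_sliceEnergy (hf : Continuous (uncurry3 f)) :
    Measurable fun q : ℝ × ℝ => sliceEnergy f q.1 q.2 :=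
  hf.measurable_enorm_sq.lintegral_prod_left'

theorem lintegral_lintegral_add {q r : ℝ → ℝ → ℝ≥0∞}
    (hq : Measurable fun p : ℝ × ℝ => q p.1 p.2) :
    ∫⁻ z, ∫⁻ y, (q y z + r y z) ∂volume ∂periodMeasure
      = (∫⁻ z, ∫⁻ y, q y z ∂volume ∂periodMeasure)
        + ∫⁻ z, ∫⁻ y, r y z ∂volume ∂periodMeasure := by
  rw [← lintegral_add_left hq.lintegral_prod_left']
  refine lintegral_congr fun z => ?_
  exact lintegral_add_left (hq.comp (f := fun y : ℝ => (y, z)) (by fun_prop)) _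

theorem L2sq_nonneg (f : ℝ → ℝ → ℝ → ℂ) : 0 ≤ L2sq f :=
  integral_nonneg fun _ => integral_nonneg fun _ => integral_nonneg fun _ => by positivity

theorem Decays.ofReal_L2sq_eq_lintegral (hf : Decays f) :
    ENNReal.ofReal (L2sq f) = ∫⁻ p, ‖f p.1 p.2.1 p.2.2‖ₑ ^ 2 ∂stripMeasure := by
  rw [L2sq, ← hf.norm_sq.integral_eq, ofReal_integral_eq_lintegral_ofReal hf.norm_sq.integrable
    (.of_forall fun p => by positivity)]
  refine lintegral_congr fun p => ?_
  rw [ENNReal.ofReal_pow (norm_nonneg _), ofReal_norm]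

theorem Decays.ofReal_L2sq (hf : Decays f) : ENNReal.ofReal (L2sq f) = energy f := by
  rw [hf.ofReal_L2sq_eq_lintegral]
  exact lintegral_stripMeasure_symm (G := fun x y z => ‖f x y z‖ₑ ^ 2) hf.cont.measurable_enorm_sq

protected theorem Decays.swapXZ (hf : Decays f) : Decays (swapXZ f) where
  cont := hf.cont.comp (f := fun p : ℝ × ℝ × ℝ => (p.2.2, p.2.1, p.1)) (by fun_prop)
  bound := hf.bound.imp fun _ h x y z => h z y x

theorem Decays.L2sq_swapXZ (hf : Decays f) : L2sq (swapXZ f) = L2sq f := by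
  rw [← ENNReal.ofReal_eq_ofReal_iff (L2sq_nonneg _) (L2sq_nonneg _), hf.swapXZ.ofReal_L2sq,
    hf.ofReal_L2sq_eq_lintegral]
  exact (lintegral_stripMeasure (G := fun x y z => ‖f x y z‖ₑ ^ 2)
    hf.cont.measurable_enorm_sq).symm

end Energy

section OneVariable

theorem integral_periodMeasure {E : Type*} [NormedAddCommGroup E] [NormedSpace ℝ E]
    (u : ℝ → E) :
    ∫ x, u x ∂periodMeasure = ∫ x in (0 : ℝ)..1, u x :=
  (intervalIntegral.integral_of_le zero_le_one).symm

theorem Continuous.integrable_periodMeasure {E : Type*} [NormedAddCommGroup E] {u : ℝ → E}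
    (hu : Continuous u) :
    Integrable u periodMeasure :=
  (hu.integrableOn_Icc (a := 0) (b := 1)).mono_set Set.Ioc_subset_Icc_self

variable {E : Type*} [NormedAddCommGroup E] [NormedSpace ℝ E] [CompleteSpace E]

theorem ae_periodMeasure {p : ℝ → Prop} (h : ∀ x ∈ Set.Icc (0 : ℝ) 1, p x) :
    ∀ᵐ x ∂periodMeasure, p x :=
  (ae_restrict_mem measurableSet_Ioc).mono fun x hx => h x (Set.Ioc_subset_Icc_self hx)

theorem enorm_sub_le_setLIntegral {u u' : ℝ → E} (hd : ∀ t, HasDerivAt u (u' t) t)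
    (hc : Continuous u') (a b : ℝ) : ‖u b - u a‖ₑ ≤ ∫⁻ t in Set.uIoc a b, ‖u' t‖ₑ := by
  rw [← intervalIntegral.integral_eq_sub_of_hasDerivAt (fun t _ => hd t)
    (hc.intervalIntegrable a b), ← ofReal_norm,
    intervalIntegral.norm_intervalIntegral_eq, ofReal_norm]
  exact enorm_integral_le_lintegral_enorm _

theorem enorm_sub_le_lintegral_period {u u' : ℝ → E} (hd : ∀ t, HasDerivAt u (u' t) t)
    (hc : Continuous u') {a b : ℝ} (ha : a ∈ Set.Icc (0 : ℝ) 1) (hb : b ∈ Set.Icc (0 : ℝ) 1) :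
    ‖u b - u a‖ₑ ≤ ∫⁻ t, ‖u' t‖ₑ ∂periodMeasure :=
  (enorm_sub_le_setLIntegral hd hc a b).trans <| lintegral_mono_set <|
    Set.Ioc_subset_Ioc (le_min ha.1 hb.1) (max_le ha.2 hb.2)

theorem enorm_le_lintegral_of_tendsto_atBot {u u' : ℝ → E} (hd : ∀ t, HasDerivAt u (u' t) t)
    (hc : Continuous u') (hu : Filter.Tendsto u Filter.atBot (nhds 0)) (b : ℝ) :
    ‖u b‖ₑ ≤ ∫⁻ t, ‖u' t‖ₑ := by
  have h : Filter.Tendsto (fun a => ‖u b - u a‖ₑ) Filter.atBot (nhds ‖u b - 0‖ₑ) :=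
    (tendsto_const_nhds.sub hu).enorm
  rw [sub_zero] at h
  exact le_of_tendsto' h fun a =>
    (enorm_sub_le_setLIntegral hd hc a b).trans (setLIntegral_le_lintegral _ _)

theorem enorm_le_lintegral_add_lintegral_period {u u' : ℝ → E}
    (hd : ∀ t, HasDerivAt u (u' t) t) (hc : Continuous u') {b : ℝ}
    (hb : b ∈ Set.Icc (0 : ℝ) 1) :
    ‖u b‖ₑ ≤ (∫⁻ t, ‖u t‖ₑ ∂periodMeasure) + ∫⁻ t, ‖u' t‖ₑ ∂periodMeasure := by
  calc ‖u b‖ₑ = ∫⁻ _, ‖u b‖ₑ ∂periodMeasure := by simp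
    _ ≤ ∫⁻ a, (‖u a‖ₑ + ∫⁻ t, ‖u' t‖ₑ ∂periodMeasure) ∂periodMeasure := by
      refine lintegral_mono_ae (ae_periodMeasure fun a ha => ?_)
      calc ‖u b‖ₑ = ‖u a + (u b - u a)‖ₑ := by rw [add_sub_cancel]
        _ ≤ ‖u a‖ₑ + ‖u b - u a‖ₑ := enorm_add_le _ _
        _ ≤ _ := by gcongr; exact enorm_sub_le_lintegral_period hd hc ha hb
    _ = _ := by rw [lintegral_add_right _ measurable_const]; simp

theorem sq_lintegral_le {α : Type*} [MeasurableSpace α] {μ : Measure α} [IsProbabilityMeasure μ]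
    {g : α → ℝ≥0∞} (hg : AEMeasurable g μ) : (∫⁻ a, g a ∂μ) ^ 2 ≤ ∫⁻ a, g a ^ 2 ∂μ := by
  have h := ENNReal.lintegral_mul_le_Lp_mul_Lq μ Real.HolderConjugate.two_two hg
    (aemeasurable_const (b := (1 : ℝ≥0∞)))
  simp only [Pi.mul_apply, mul_one, ENNReal.one_rpow, lintegral_const, measure_univ] at h
  calc _ ≤ ((∫⁻ a, g a ^ (2 : ℝ) ∂μ) ^ (1 / (2 : ℝ))) ^ 2 := by gcongr
    _ = _ := by
      rw [← ENNReal.rpow_natCast, ← ENNReal.rpow_mul]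
      norm_num

theorem lintegral_enorm_sq_le_of_integral_eq_zero {u u' : ℝ → E}
    (hd : ∀ t, HasDerivAt u (u' t) t) (hc : Continuous u')
    (h0 : ∫ t, u t ∂periodMeasure = 0) :
    ∫⁻ t, ‖u t‖ₑ ^ 2 ∂periodMeasure ≤ ∫⁻ t, ‖u' t‖ₑ ^ 2 ∂periodMeasure := by
  have hu : Continuous u := continuous_iff_continuousAt.2 fun t => (hd t).continuousAt
  have key : ∀ b ∈ Set.Icc (0 : ℝ) 1, ‖u b‖ₑ ≤ ∫⁻ t, ‖u' t‖ₑ ∂periodMeasure := by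
    intro b hb
    have : u b = ∫ a, (u b - u a) ∂periodMeasure := by
      rw [integral_sub (integrable_const _) hu.integrable_periodMeasure, h0]
      simp
    rw [this]
    refine (enorm_integral_le_lintegral_enorm _).trans ?_
    calc _ ≤ ∫⁻ _, (∫⁻ t, ‖u' t‖ₑ ∂periodMeasure) ∂periodMeasure :=
          lintegral_mono_ae (ae_periodMeasure fun a ha =>
            enorm_sub_le_lintegral_period hd hc ha hb)
      _ = _ := by simp
  calc _ ≤ ∫⁻ _, (∫⁻ t, ‖u' t‖ₑ ^ 2 ∂periodMeasure) ∂periodMeasure :=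
        lintegral_mono_ae (ae_periodMeasure fun b hb =>
          (pow_le_pow_left' (key b hb) 2).trans
            (sq_lintegral_le hc.enorm.measurable.aemeasurable))
    _ = _ := by simp

end OneVariable

section ParametricIntegral

variable {E : Type*} [NormedAddCommGroup E] [NormedSpace ℝ E]

theorem hasDerivAt_integral_period {F F' : ℝ → ℝ → E}
    (hF : Continuous fun p : ℝ × ℝ => F p.1 p.2) (hF' : Continuous fun p : ℝ × ℝ => F' p.1 p.2)
    (hd : ∀ x t, HasDerivAt (F x) (F' x t) t) (t : ℝ) :
    HasDerivAt (fun t => ∫ x, F x t ∂periodMeasure) (∫ x, F' x t ∂periodMeasure) t := by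
  obtain ⟨C, hC⟩ := (isCompact_Icc.prod (isCompact_closedBall t 1)).exists_bound_of_continuousOn
    (s := Set.Icc (0 : ℝ) 1 ×ˢ Metric.closedBall t 1) hF'.continuousOn
  have hF1 : ∀ t, Continuous fun x => F x t := fun t =>
    hF.comp (f := fun x : ℝ => (x, t)) (by fun_prop)
  refine (hasDerivAt_integral_of_dominated_loc_of_deriv_le (bound := fun _ => C)
    (Metric.ball_mem_nhds t one_pos) (.of_forall fun t => (hF1 t).aestronglyMeasurable)
    (hF1 t).integrable_periodMeasure
    (hF'.comp (f := fun x : ℝ => (x, t)) (by fun_prop)).aestronglyMeasurable ?_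
    (integrable_const C) (.of_forall fun x s _ => hd x s)).2
  exact ae_periodMeasure fun x hx s hs => hC (x, s) ⟨hx, Metric.ball_subset_closedBall hs⟩

theorem continuous_integral_period {F : ℝ → ℝ → E}
    (hF : Continuous fun p : ℝ × ℝ => F p.1 p.2) :
    Continuous fun t => ∫ x, F x t ∂periodMeasure := by
  simp only [integral_periodMeasure]
  exact intervalIntegral.continuous_parametric_intervalIntegral_of_continuous'
    (f := fun t x => F x t) (hF.comp continuous_swap) 0 1

end ParametricIntegral

theorem Decays.tendsto_integral_period {F : ℝ → ℝ → ℝ → ℝ} (hF : Decays F) (z : ℝ) :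
    Filter.Tendsto (fun y => ∫ x, F x y z ∂periodMeasure) Filter.atBot (nhds 0) := by
  obtain ⟨C, hC⟩ := hF.bound
  have h : Decays fun _ y _ : ℝ => C * (1 + y ^ 2)⁻¹ :=
    ⟨by
      have : ∀ p : ℝ × ℝ × ℝ, 1 + p.2.1 ^ 2 ≠ 0 := fun p => by positivity
      fun_prop (disch := assumption), |C|, fun x y z => by
        rw [norm_mul, Real.norm_eq_abs, Real.norm_of_nonneg (by positivity)]⟩
  refine squeeze_zero_norm (fun y => ?_) (h.tendsto_atBot 0 0)
  simpa using norm_integral_le_of_norm_le_const (μ := periodMeasure) (f := fun x => F x y z)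
    (.of_forall fun x => hC x y z)

theorem enorm_integral_period_le {F Fy Fz Fzy : ℝ → ℝ → ℝ → ℝ} {q r : ℝ → ℝ → ℝ≥0∞}
    (hF : Decays F) (hFy : Decays Fy) (hFz : Decays Fz) (hFzy : Decays Fzy)
    (hdy : ∀ x y z, HasDerivAt (fun t => F x t z) (Fy x y z) y)
    (hdz : ∀ x y z, HasDerivAt (fun t => F x y t) (Fz x y z) z)
    (hdzy : ∀ x y z, HasDerivAt (fun t => Fz x t z) (Fzy x y z) y)
    (hq : ∀ y z, ‖∫ x, Fy x y z ∂periodMeasure‖ₑ ≤ q y z)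
    (hr : ∀ y z, ‖∫ x, Fzy x y z ∂periodMeasure‖ₑ ≤ r y z)
    (y : ℝ) {z : ℝ} (hz : z ∈ Set.Icc (0 : ℝ) 1) :
    ‖∫ x, F x y z ∂periodMeasure‖ₑ ≤ (∫⁻ z, ∫⁻ y, q y z ∂volume ∂periodMeasure)
      + ∫⁻ z, ∫⁻ y, r y z ∂volume ∂periodMeasure := by
  have cy : ∀ {G : ℝ → ℝ → ℝ → ℝ}, Decays G → ∀ z, Continuous fun p : ℝ × ℝ => G p.1 p.2 z :=
    fun hG z => hG.cont.comp (f := fun p : ℝ × ℝ => (p.1, p.2, z)) (by fun_prop)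
  have cz : ∀ {G : ℝ → ℝ → ℝ → ℝ}, Decays G → ∀ y, Continuous fun p : ℝ × ℝ => G p.1 y p.2 :=
    fun hG y => hG.cont.comp (f := fun p : ℝ × ℝ => (p.1, y, p.2)) (by fun_prop)
  have key : ∀ {G G' : ℝ → ℝ → ℝ → ℝ} {s : ℝ → ℝ → ℝ≥0∞}, Decays G → Decays G' →
      (∀ x y z, HasDerivAt (fun t => G x t z) (G' x y z) y) →
      (∀ y z, ‖∫ x, G' x y z ∂periodMeasure‖ₑ ≤ s y z) → ∀ z,
      ‖∫ x, G x y z ∂periodMeasure‖ₑ ≤ ∫⁻ y, s y z := fun hG hG' hd hs z =>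
    (enorm_le_lintegral_of_tendsto_atBot
      (hasDerivAt_integral_period (cy hG z) (cy hG' z) fun x t => hd x t z)
      (continuous_integral_period (cy hG' z)) (hG.tendsto_integral_period z) y).trans
      (lintegral_mono fun t => hs t z)
  refine (enorm_le_lintegral_add_lintegral_period
    (hasDerivAt_integral_period (cz hF y) (cz hFz y) fun x t => hdz x y t)
    (continuous_integral_period (cz hFz y)) hz).trans ?_
  exact add_le_add (lintegral_mono fun s => key hF hFy hdy hq s)
    (lintegral_mono fun s => key hFz hFzy hdzy hr s)

section SliceBounds

variable {u v f g : ℝ → ℝ → ℝ → ℂ}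

theorem Decays.continuous_x {E : Type*} [NormedAddCommGroup E] {F : ℝ → ℝ → ℝ → E}
    (hF : Decays F) (y z : ℝ) : Continuous fun x => F x y z :=
  hF.cont.comp (f := fun x : ℝ => (x, y, z)) (by fun_prop)

theorem Decays.integrable_inner_add_inner {w₁ w₂ : ℝ → ℝ → ℝ → ℂ} (hu : Decays u) (hv : Decays v)
    (hw₁ : Decays w₁) (hw₂ : Decays w₂) (y z : ℝ) :
    Integrable (fun x => inner ℝ (u x y z) (v x y z) + inner ℝ (w₁ x y z) (w₂ x y z))
      periodMeasure :=
  (((hu.inner hv).add (hw₁.inner hw₂)).continuous_x y z).integrable_periodMeasure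

theorem enorm_inner_self (a : ℂ) : ‖inner ℝ a a‖ₑ = ‖a‖ₑ ^ 2 := by
  rw [real_inner_self_eq_norm_sq, enorm_pow, enorm_norm]

theorem enorm_inner_add_inner_le (a b : ℂ) :
    ‖inner ℝ a b + inner ℝ b a‖ₑ ≤ ‖a‖ₑ ^ 2 + ‖b‖ₑ ^ 2 := by
  rw [← ofReal_norm, ← ofReal_norm a, ← ofReal_norm b, ← ENNReal.ofReal_pow (norm_nonneg _),
    ← ENNReal.ofReal_pow (norm_nonneg _), ← ENNReal.ofReal_add (by positivity) (by positivity)]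
  refine ENNReal.ofReal_le_ofReal ?_
  have h := norm_inner_le_norm (𝕜 := ℝ) a b
  rw [real_inner_comm a b, ← two_mul, norm_mul, Real.norm_ofNat]
  nlinarith [sq_nonneg (‖a‖ - ‖b‖)]

theorem sliceEnergy_add (hu : Decays u) (y z : ℝ) :
    ∫⁻ x, (‖u x y z‖ₑ ^ 2 + ‖v x y z‖ₑ ^ 2) ∂periodMeasure
      = sliceEnergy u y z + sliceEnergy v y z :=
  lintegral_add_left ((hu.continuous_x y z).measurable.enorm.pow_const 2) _

theorem Decays.sliceEnergy_eq (hu : Decays u) (y z : ℝ) :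
    sliceEnergy u y z = ‖∫ x, inner ℝ (u x y z) (u x y z) ∂periodMeasure‖ₑ := by
  have h0 : ∀ x, 0 ≤ inner ℝ (u x y z) (u x y z) := fun x => real_inner_self_nonneg
  rw [Real.enorm_of_nonneg (integral_nonneg h0), ofReal_integral_eq_lintegral_ofReal
    ((hu.inner hu).continuous_x y z).integrable_periodMeasure (.of_forall h0)]
  refine lintegral_congr fun x => ?_
  rw [← Real.enorm_of_nonneg (h0 x), enorm_inner_self]

theorem Decays.enorm_integral_inner_le (hu : Decays u) (y z : ℝ) :
    ‖∫ x, (inner ℝ (u x y z) (v x y z) + inner ℝ (v x y z) (u x y z)) ∂periodMeasure‖ₑ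
      ≤ sliceEnergy u y z + sliceEnergy v y z := by
  rw [← sliceEnergy_add hu]
  exact (enorm_integral_le_lintegral_enorm _).trans
    (lintegral_mono fun x => enorm_inner_add_inner_le _ _)

theorem Decays.measurable_sliceEnergy (hu : Decays u) :
    Measurable fun q : ℝ × ℝ => sliceEnergy u q.1 q.2 :=
  Continuous.measurable_sliceEnergy hu.cont

theorem Decays.lintegral_sliceEnergy_add (hu : Decays u) :
    ∫⁻ z, ∫⁻ y, (sliceEnergy u y z + sliceEnergy v y z) ∂volume ∂periodMeasure
      = energy u + energy v :=
  lintegral_lintegral_add hu.measurable_sliceEnergy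

theorem Decays.lintegral_sliceEnergy_add₄ {w₁ w₂ : ℝ → ℝ → ℝ → ℂ} (hu : Decays u)
    (hv : Decays v) (hw : Decays w₁) :
    ∫⁻ z, ∫⁻ y, ((sliceEnergy u y z + sliceEnergy v y z)
        + (sliceEnergy w₁ y z + sliceEnergy w₂ y z)) ∂volume ∂periodMeasure
      = (energy u + energy v) + (energy w₁ + energy w₂) := by
  rw [lintegral_lintegral_add (q := fun y z => sliceEnergy u y z + sliceEnergy v y z)
    (hu.measurable_sliceEnergy.add hv.measurable_sliceEnergy),
    hu.lintegral_sliceEnergy_add, hw.lintegral_sliceEnergy_add]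

namespace GoodFn

theorem sliceEnergy_le_lintegral (hg : GoodFn g) {q r : ℝ → ℝ → ℝ≥0∞}
    (hq : ∀ y z, ‖∫ x, (inner ℝ (g x y z) (pdy g x y z)
      + inner ℝ (pdy g x y z) (g x y z)) ∂periodMeasure‖ₑ ≤ q y z)
    (hr : ∀ y z, ‖∫ x, ((inner ℝ (g x y z) (pdy (pdz g) x y z)
      + inner ℝ (pdy g x y z) (pdz g x y z))
      + (inner ℝ (pdz g x y z) (pdy g x y z)
      + inner ℝ (pdy (pdz g) x y z) (g x y z))) ∂periodMeasure‖ₑ ≤ r y z)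
    (y : ℝ) {z : ℝ} (hz : z ∈ Set.Icc (0 : ℝ) 1) :
    sliceEnergy g y z ≤ (∫⁻ z, ∫⁻ y, q y z ∂volume ∂periodMeasure)
      + ∫⁻ z, ∫⁻ y, r y z ∂volume ∂periodMeasure := by
  have d := hg.decays
  have dy := hg.pdy.decays
  have dz := hg.pdz.decays
  have dyz := hg.pdz.pdy.decays
  have s := hg.smooth3
  rw [d.sliceEnergy_eq]
  exact enorm_integral_period_le (d.inner d) ((d.inner dy).add (dy.inner d))
    ((d.inner dz).add (dz.inner d))
    (((d.inner dyz).add (dy.inner dz)).add ((dz.inner dy).add (dyz.inner d)))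
    (fun x y z => (s.hasDerivAt_y x y z).inner ℝ (s.hasDerivAt_y x y z))
    (fun x y z => (s.hasDerivAt_z x y z).inner ℝ (s.hasDerivAt_z x y z))
    (fun x y z => ((s.hasDerivAt_y x y z).inner ℝ (s.pdz.hasDerivAt_y x y z)).add
      ((s.pdz.hasDerivAt_y x y z).inner ℝ (s.hasDerivAt_y x y z))) hq hr y hz

theorem sliceEnergy_le (hg : GoodFn g) (y : ℝ) {z : ℝ} (hz : z ∈ Set.Icc (0 : ℝ) 1) :
    sliceEnergy g y z ≤ (energy g + energy (pdy g))
      + ((energy g + energy (pdy (pdz g)))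
        + (energy (pdy g) + energy (pdz g))) := by
  have d := hg.decays
  have dy := hg.pdy.decays
  have dz := hg.pdz.decays
  have dyz := hg.pdz.pdy.decays
  rw [← d.lintegral_sliceEnergy_add, ← d.lintegral_sliceEnergy_add₄ dyz dy]
  refine hg.sliceEnergy_le_lintegral (fun y z => d.enorm_integral_inner_le y z)
    (fun y z => ?_) y hz
  refine le_trans ?_ (add_le_add (d.enorm_integral_inner_le y z) (dy.enorm_integral_inner_le y z))
  refine le_trans (le_of_eq ?_) (enorm_add_le _ _)
  rw [← integral_add (d.integrable_inner_add_inner dyz dyz d y z)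
    (dy.integrable_inner_add_inner dz dz dy y z)]
  congr 2
  funext x
  ring

theorem integral_pdx_eq_zero (hf : GoodFn f) (y z : ℝ) :
    ∫ x, pdx f x y z ∂periodMeasure = 0 := by
  rw [integral_periodMeasure, intervalIntegral.integral_eq_sub_of_hasDerivAt
    (fun x _ => hf.smooth3.hasDerivAt_x x y z)
    ((hf.pdx.decays.continuous_x y z).intervalIntegrable _ _), sub_eq_zero]
  simpa using hf.per_x 0 y z

theorem integral_pdx_inner_eq_zero (hu : GoodFn u) (hv : GoodFn v) (y z : ℝ) :
    ∫ x, (inner ℝ (u x y z) (pdx v x y z) + inner ℝ (pdx u x y z) (v x y z))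
      ∂periodMeasure = 0 := by
  rw [integral_periodMeasure, intervalIntegral.integral_eq_sub_of_hasDerivAt
    (fun x _ => (hu.smooth3.hasDerivAt_x x y z).inner ℝ (hv.smooth3.hasDerivAt_x x y z))
    ((((hu.decays.inner hv.pdx.decays).add
      (hu.pdx.decays.inner hv.decays)).continuous_x y z).intervalIntegrable _ _), sub_eq_zero]
  have h1 := hu.per_x 0 y z
  have h2 := hv.per_x 0 y z
  rw [zero_add] at h1 h2
  rw [h1, h2]

theorem sliceEnergy_pdx_le_pdx_pdx (hf : GoodFn f) (y z : ℝ) :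
    sliceEnergy (pdx f) y z ≤ sliceEnergy (pdx (pdx f)) y z :=
  lintegral_enorm_sq_le_of_integral_eq_zero (fun x => hf.pdx.smooth3.hasDerivAt_x x y z)
    (hf.pdx.pdx.decays.continuous_x y z) (hf.integral_pdx_eq_zero y z)

theorem sliceEnergy_pdx_le (hf : GoodFn f) (y : ℝ) {z : ℝ} (hz : z ∈ Set.Icc (0 : ℝ) 1) :
    sliceEnergy (pdx f) y z
      ≤ (energy (pdx (pdx f)) + energy (pdx (pdy f)))
      + ((energy (pdx (pdy f)) + energy (pdx (pdz f)))
        + (energy (pdx (pdx f)) + energy (pdy (pdz f)))) := by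
  have d := hf.pdx.decays
  have dx := hf.pdx.pdx.decays
  have dy := hf.pdy.pdx.decays
  have dz := hf.pdz.pdx.decays
  have w := hf.pdz.pdy
  have ey := hf.smooth3.pdx_pdy
  have ez := hf.smooth3.pdx_pdz
  have eyz : pdx (pdy (pdz f)) = pdy (pdz (pdx f)) := by
    rw [hf.pdz.smooth3.pdx_pdy, ez]
  rw [← dx.lintegral_sliceEnergy_add, ← dy.lintegral_sliceEnergy_add₄ dz dx]
  refine hf.pdx.sliceEnergy_le_lintegral (fun y z => ?_) (fun y z => ?_) y hz
  · rw [← ey]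
    exact (d.enorm_integral_inner_le y z).trans
      (add_le_add (hf.sliceEnergy_pdx_le_pdx_pdx y z) le_rfl)
  · rw [← ey, ← eyz, ← ez]
    refine le_trans ?_ (add_le_add (dy.enorm_integral_inner_le y z)
      (dx.enorm_integral_inner_le y z))
    refine le_trans (le_of_eq ?_) (enorm_sub_le)
    have i1 := dy.integrable_inner_add_inner dz dz dy y z
    have i2 := dx.integrable_inner_add_inner w.decays w.decays dx y z
    have i3 := d.integrable_inner_add_inner w.pdx.decays dx w.decays y z
    have h0 := hf.pdx.integral_pdx_inner_eq_zero w y z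
    have key := integral_add (i1.sub i2) (i3.const_mul 2)
    rw [integral_const_mul, h0, mul_zero, add_zero, integral_sub' i1 i2] at key
    rw [← key]
    congr 2
    funext x
    simp only [Pi.sub_apply, real_inner_comm (pdx (pdx f) x y z), real_inner_comm (pdx f x y z)]
    ring

theorem sliceEnergy_pdx_le_lap (hf : GoodFn f) (y : ℝ) {z : ℝ} (hz : z ∈ Set.Icc (0 : ℝ) 1) :
    sliceEnergy (pdx f) y z ≤ ENNReal.ofReal (2 * L2sq (lap f)) := by
  have n := L2sq_nonneg
  refine (hf.sliceEnergy_pdx_le y hz).trans ?_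
  rw [← hf.pdx.pdx.decays.ofReal_L2sq, ← hf.pdy.pdx.decays.ofReal_L2sq,
    ← hf.pdz.pdx.decays.ofReal_L2sq, ← hf.pdz.pdy.decays.ofReal_L2sq,
    ← ENNReal.ofReal_add (n _) (n _), ← ENNReal.ofReal_add (n _) (n _),
    ← ENNReal.ofReal_add (n _) (n _), ← ENNReal.ofReal_add (add_nonneg (n _) (n _))
      (add_nonneg (n _) (n _)), ← ENNReal.ofReal_add (add_nonneg (n _) (n _))
      (add_nonneg (add_nonneg (n _) (n _)) (add_nonneg (n _) (n _)))]
  refine ENNReal.ofReal_le_ofReal ?_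
  rw [hf.L2sq_lap]
  linarith [n (pdx (pdx f)), n (pdy (pdy f)),
    n (pdz (pdz f)), n (pdx (pdy f)),
    n (pdx (pdz f)), n (pdy (pdz f))]

theorem sliceEnergy_le_ofReal (hg : GoodFn g) {K : ℝ} (h : L2sq g ≤ K)
    (hy : L2sq (pdy g) ≤ K) (hz : L2sq (pdz g) ≤ K)
    (hyz : L2sq (pdy (pdz g)) ≤ K) (y : ℝ) {z : ℝ} (hz01 : z ∈ Set.Icc (0 : ℝ) 1) :
    sliceEnergy g y z ≤ ENNReal.ofReal (6 * K) := by
  have n := L2sq_nonneg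
  refine (hg.sliceEnergy_le y hz01).trans ?_
  rw [← hg.decays.ofReal_L2sq, ← hg.pdy.decays.ofReal_L2sq,
    ← hg.pdz.decays.ofReal_L2sq, ← hg.pdz.pdy.decays.ofReal_L2sq,
    ← ENNReal.ofReal_add (n _) (n _), ← ENNReal.ofReal_add (n _) (n _),
    ← ENNReal.ofReal_add (n _) (n _), ← ENNReal.ofReal_add (add_nonneg (n _) (n _))
      (add_nonneg (n _) (n _)), ← ENNReal.ofReal_add (add_nonneg (n _) (n _))
      (add_nonneg (add_nonneg (n _) (n _)) (add_nonneg (n _) (n _)))]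
  exact ENNReal.ofReal_le_ofReal (by linarith)

theorem enorm_sq_le (hu : GoodFn u) {x : ℝ} (hx : x ∈ Set.Icc (0 : ℝ) 1) (y z : ℝ) :
    ‖u x y z‖ₑ ^ 2 ≤ sliceEnergy u y z
      + (sliceEnergy u y z + sliceEnergy (pdx u) y z) := by
  have d := hu.decays
  have dx := hu.pdx.decays
  rw [← enorm_inner_self]
  refine (enorm_le_lintegral_add_lintegral_period
    (u := fun x => inner ℝ (u x y z) (u x y z))
    (fun x => (hu.smooth3.hasDerivAt_x x y z).inner ℝ (hu.smooth3.hasDerivAt_x x y z))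
    (((d.inner dx).add (dx.inner d)).continuous_x y z) hx).trans ?_
  simp only [enorm_inner_self]
  rw [← sliceEnergy_add d (v := pdx u)]
  exact add_le_add le_rfl (lintegral_mono fun t => enorm_inner_add_inner_le _ _)

end GoodFn

theorem energy_mul_le_of_sliceEnergy_le (hu : GoodFn u) (hv : Decays v) {M : ℝ≥0∞} (hM : M ≠ ∞)
    (h : ∀ y, ∀ z ∈ Set.Icc (0 : ℝ) 1, sliceEnergy v y z ≤ M) :
    energy (fun x y z => u x y z * v x y z)
      ≤ (energy u + (energy u + energy (pdx u))) * M := by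
  have e : energy u + (energy u + energy (pdx u)) = ∫⁻ z, ∫⁻ y, (sliceEnergy u y z
      + (sliceEnergy u y z + sliceEnergy (pdx u) y z)) ∂volume ∂periodMeasure := by
    rw [lintegral_lintegral_add hu.decays.measurable_sliceEnergy,
      hu.decays.lintegral_sliceEnergy_add]
    rfl
  rw [e, ← lintegral_mul_const' _ _ hM]
  refine lintegral_mono_ae (ae_periodMeasure fun z hz => ?_)
  rw [← lintegral_mul_const' _ _ hM]
  refine lintegral_mono fun y => ?_
  refine le_trans ?_ (mul_le_mul_right (h y z hz) _)
  rw [sliceEnergy, sliceEnergy.eq_1 v, ← lintegral_const_mul _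
    ((hv.continuous_x y z).measurable.enorm.pow_const 2)]
  refine lintegral_mono_ae (ae_periodMeasure fun x hx => ?_)
  rw [enorm_mul, mul_pow]
  gcongr
  exact hu.enorm_sq_le hx y z

theorem energy_mul_le_of_enorm_sq_le {M : ℝ≥0∞} (hM : M ≠ ∞)
    (h : ∀ x ∈ Set.Icc (0 : ℝ) 1, ∀ y, ∀ z ∈ Set.Icc (0 : ℝ) 1, ‖v x y z‖ₑ ^ 2 ≤ M) :
    energy (fun x y z => u x y z * v x y z) ≤ energy u * M := by
  rw [energy, energy, ← lintegral_mul_const' _ _ hM]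
  refine lintegral_mono_ae (ae_periodMeasure fun z hz => ?_)
  rw [← lintegral_mul_const' _ _ hM]
  refine lintegral_mono fun y => ?_
  rw [sliceEnergy, sliceEnergy, ← lintegral_mul_const' _ _ hM]
  refine lintegral_mono_ae (ae_periodMeasure fun x hx => ?_)
  rw [enorm_mul, mul_pow]
  gcongr
  exact h x hx y z hz

end SliceBounds

section Estimates

variable {u v f g : ℝ → ℝ → ℝ → ℂ}

theorem L2sq_add_le (hu : Decays u) (hv : Decays v) :
    L2sq (u + v) ≤ 2 * L2sq u + 2 * L2sq v := by
  have huv : Decays (u + v) := hu.add hv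
  simp only [L2sq, ← huv.norm_sq.integral_eq, ← hu.norm_sq.integral_eq, ← hv.norm_sq.integral_eq,
    ← integral_const_mul]
  rw [← integral_add (hu.norm_sq.integrable.const_mul 2) (hv.norm_sq.integrable.const_mul 2)]
  refine integral_mono huv.norm_sq.integrable
    ((hu.norm_sq.integrable.const_mul 2).add (hv.norm_sq.integrable.const_mul 2)) fun p => ?_
  have h := norm_add_le (u p.1 p.2.1 p.2.2) (v p.1 p.2.1 p.2.2)
  simp only [Pi.add_apply]
  nlinarith [sq_nonneg (‖u p.1 p.2.1 p.2.2‖ - ‖v p.1 p.2.1 p.2.2‖),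
    norm_nonneg (u p.1 p.2.1 p.2.2 + v p.1 p.2.1 p.2.2)]

theorem L2sq_mul_le_of_sliceEnergy_le (hu : GoodFn u) (hv : Decays v) {M : ℝ} (hM : 0 ≤ M)
    (h : ∀ y, ∀ z ∈ Set.Icc (0 : ℝ) 1, sliceEnergy v y z ≤ ENNReal.ofReal M) :
    L2sq (fun x y z => u x y z * v x y z) ≤ (2 * L2sq u + L2sq (pdx u)) * M := by
  have n := L2sq_nonneg
  have e := energy_mul_le_of_sliceEnergy_le hu hv ENNReal.ofReal_ne_top h
  rw [← (hu.decays.mul hv).ofReal_L2sq, ← hu.decays.ofReal_L2sq, ← hu.pdx.decays.ofReal_L2sq,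
    ← ENNReal.ofReal_add (n _) (n _), ← ENNReal.ofReal_add (n _) (add_nonneg (n _) (n _)),
    ← ENNReal.ofReal_mul (add_nonneg (n _) (add_nonneg (n _) (n _))), ENNReal.ofReal_le_ofReal_iff
      (mul_nonneg (add_nonneg (n _) (add_nonneg (n _) (n _))) hM)] at e
  linarith

theorem L2sq_mul_le_of_enorm_sq_le (hu : Decays u) (hv : Decays v) {M : ℝ} (hM : 0 ≤ M)
    (h : ∀ x ∈ Set.Icc (0 : ℝ) 1, ∀ y, ∀ z ∈ Set.Icc (0 : ℝ) 1,
      ‖v x y z‖ₑ ^ 2 ≤ ENNReal.ofReal M) :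
    L2sq (fun x y z => u x y z * v x y z) ≤ L2sq u * M := by
  have e := energy_mul_le_of_enorm_sq_le (u := u) ENNReal.ofReal_ne_top h
  rwa [← (hu.mul hv).ofReal_L2sq, ← hu.ofReal_L2sq, ← ENNReal.ofReal_mul (L2sq_nonneg _),
    ENNReal.ofReal_le_ofReal_iff (mul_nonneg (L2sq_nonneg _) hM)] at e

theorem GoodFn.pdx_mul (hu : GoodFn u) (hv : GoodFn v) :
    pdx (fun x y z => u x y z * v x y z)
      = (fun x y z => pdx u x y z * v x y z) + fun x y z => u x y z * pdx v x y z := by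
  funext x y z
  exact ((hu.smooth3.hasDerivAt_x x y z).mul (hv.smooth3.hasDerivAt_x x y z)).deriv

theorem L2norm_le_of_sq_le {A B K c : ℝ} (hc : 0 ≤ c) (hA : 0 ≤ A) (hB : 0 ≤ B) (hK : 0 ≤ K)
    (h : L2sq u ≤ c ^ 2 * (A + B) * K) : L2norm u ≤ c * (√A + √B) * √K := by
  refine Real.sqrt_le_iff.2 ⟨by positivity, h.trans ?_⟩
  rw [mul_pow, mul_pow, Real.sq_sqrt hK]
  gcongr
  nlinarith [Real.sq_sqrt hA, Real.sq_sqrt hB, Real.sqrt_nonneg A, Real.sqrt_nonneg B,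
    mul_nonneg (Real.sqrt_nonneg A) (Real.sqrt_nonneg B)]

theorem product_estimates_pdx (hf : GoodFn f) (hg : GoodFn g) {K : ℝ} (h : L2sq g ≤ K)
    (hy : L2sq (pdy g) ≤ K) (hz : L2sq (pdz g) ≤ K) (hyz : L2sq (pdy (pdz g)) ≤ K)
    (hl : L2sq (lap g) ≤ 9 * K) :
    L2norm (fun x y z => f x y z * pdx g x y z)
      ≤ 16 * (L2norm (pdx f) + L2norm f) * L2norm (lap g) ∧
    L2norm (fun x y z => f x y z * g x y z) + L2norm (pdx fun x y z => f x y z * g x y z)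
      ≤ 16 * (L2norm (pdx f) + L2norm f) * √K := by
  have n := L2sq_nonneg
  have hK : 0 ≤ K := (n g).trans h
  have slice₁ : ∀ y, ∀ z ∈ Set.Icc (0 : ℝ) 1,
      sliceEnergy (pdx g) y z ≤ ENNReal.ofReal (2 * L2sq (lap g)) := fun y z hz =>
    hg.sliceEnergy_pdx_le_lap y hz
  have slice₀ : ∀ y, ∀ z ∈ Set.Icc (0 : ℝ) 1, sliceEnergy g y z ≤ ENNReal.ofReal (6 * K) :=
    fun y z hz01 => hg.sliceEnergy_le_ofReal h hy hz hyz y hz01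
  have sup : ∀ x ∈ Set.Icc (0 : ℝ) 1, ∀ y, ∀ z ∈ Set.Icc (0 : ℝ) 1,
      ‖g x y z‖ₑ ^ 2 ≤ ENNReal.ofReal (30 * K) := by
    intro x hx y z hz
    refine (hg.enorm_sq_le hx y z).trans ((add_le_add (slice₀ y z hz)
      (add_le_add (slice₀ y z hz) (slice₁ y z hz))).trans ?_)
    rw [← ENNReal.ofReal_add (by positivity) (mul_nonneg zero_le_two (n _)),
      ← ENNReal.ofReal_add (by positivity) (add_nonneg (by positivity)
        (mul_nonneg zero_le_two (n _)))]
    exact ENNReal.ofReal_le_ofReal (by linarith)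
  have b₁ := L2sq_mul_le_of_sliceEnergy_le hf hg.pdx.decays (mul_nonneg zero_le_two (n _)) slice₁
  have b₂ := L2sq_mul_le_of_sliceEnergy_le hf hg.decays (by positivity) slice₀
  have b₃ := L2sq_mul_le_of_enorm_sq_le hf.pdx.decays hg.decays (by positivity) sup
  have b₄ := L2sq_add_le (hf.pdx.decays.mul hg.decays) (hf.decays.mul hg.pdx.decays)
  rw [← hf.pdx_mul hg] at b₄
  have nf := n f
  have nx := n (pdx f)
  have nl := n (lap g)
  have p₁ := mul_nonneg nf hK
  have p₂ := mul_nonneg nx hK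
  have q₁ := mul_nonneg nf nl
  have q₂ := mul_nonneg nx nl
  have r₁ := mul_le_mul_of_nonneg_left hl nf
  have r₂ := mul_le_mul_of_nonneg_left hl nx
  refine ⟨L2norm_le_of_sq_le (by norm_num) nx nf nl (by nlinarith), ?_⟩
  have c₁ : L2norm (fun x y z => f x y z * g x y z) ≤ 4 * (√(L2sq (pdx f)) + √(L2sq f)) * √K :=
    L2norm_le_of_sq_le (by norm_num) nx nf hK (by nlinarith)
  have c₂ : L2norm (pdx fun x y z => f x y z * g x y z)
      ≤ 12 * (√(L2sq (pdx f)) + √(L2sq f)) * √K :=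
    L2norm_le_of_sq_le (by norm_num) nx nf hK (by nlinarith)
  simp only [L2norm] at c₁ c₂ ⊢
  linarith

theorem L2sq_pderiv3_le_HNsq {N : ℕ} {α : ℕ × ℕ × ℕ} (hα : α ∈ multiIndicesLe N) :
    L2sq (pderiv3 α f) ≤ HNsq N f :=
  Finset.single_le_sum (f := fun α => L2sq (pderiv3 α f)) (fun _ _ => L2sq_nonneg _) hα

theorem GoodFn.L2sq_lap_le_HNsq (hf : GoodFn f) : L2sq (lap f) ≤ 9 * HNsq 2 f := by
  have h : ∀ α ∈ multiIndicesLe 2, L2sq (pderiv3 α f) ≤ HNsq 2 f := fun α hα =>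
    L2sq_pderiv3_le_HNsq hα
  have hxx : L2sq (pdx (pdx f)) ≤ HNsq 2 f := h (2, 0, 0) (by decide)
  have hyy : L2sq (pdy (pdy f)) ≤ HNsq 2 f := h (0, 2, 0) (by decide)
  have hzz : L2sq (pdz (pdz f)) ≤ HNsq 2 f := h (0, 0, 2) (by decide)
  have hxy : L2sq (pdx (pdy f)) ≤ HNsq 2 f := h (1, 1, 0) (by decide)
  have hxz : L2sq (pdx (pdz f)) ≤ HNsq 2 f := h (1, 0, 1) (by decide)
  have hyz : L2sq (pdy (pdz f)) ≤ HNsq 2 f := h (0, 1, 1) (by decide)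
  rw [hf.L2sq_lap]
  linarith

theorem Decays.L2norm_swapXZ (hf : Decays f) : L2norm (swapXZ f) = L2norm f := by
  rw [L2norm, hf.L2sq_swapXZ, L2norm]

theorem lap_swapXZ (f : ℝ → ℝ → ℝ → ℂ) : lap (swapXZ f) = swapXZ (lap f) := by
  change swapXZ (pdz (pdz f)) + swapXZ (pdy (pdy f)) + swapXZ (pdx (pdx f)) = _
  funext x y z
  simp only [lap, swapXZ, Pi.add_apply]
  ring

end Estimates

/-- For `∂_j ∈ {∂_x, ∂_z}`:
(i) `‖f₁ ∂_j f₂‖_{L²} ≤ C(‖∂_j f₁‖_{L²} + ‖f₁‖_{L²})‖Δ f₂‖_{L²}`;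
(ii) `‖f₁ f₂‖_{L²} + ‖∂_j(f₁ f₂)‖_{L²} ≤ C(‖∂_j f₁‖_{L²} + ‖f₁‖_{L²})‖f₂‖_{H²}`. -/
theorem stmt15 : ∃ C : ℝ, 0 < C ∧ ∀ f₁ f₂ : ℝ → ℝ → ℝ → ℂ,
    GoodFn f₁ → GoodFn f₂ →
    ∀ D : (ℝ → ℝ → ℝ → ℂ) → (ℝ → ℝ → ℝ → ℂ), (D = pdx ∨ D = pdz) →
    L2norm (fun x y z => f₁ x y z * D f₂ x y z)
      ≤ C * (L2norm (D f₁) + L2norm f₁) * L2norm (lap f₂) ∧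
    L2norm (fun x y z => f₁ x y z * f₂ x y z)
        + L2norm (D (fun x y z => f₁ x y z * f₂ x y z))
      ≤ C * (L2norm (D f₁) + L2norm f₁) * HN 2 f₂ := by
  refine ⟨16, by norm_num, fun f g hf hg D hD => ?_⟩
  have h : ∀ α ∈ multiIndicesLe 2, L2sq (pderiv3 α g) ≤ HNsq 2 g := fun α hα =>
    L2sq_pderiv3_le_HNsq hα
  have h0 : L2sq g ≤ HNsq 2 g := h (0, 0, 0) (by decide)
  have hx : L2sq (pdx g) ≤ HNsq 2 g := h (1, 0, 0) (by decide)
  have hy : L2sq (pdy g) ≤ HNsq 2 g := h (0, 1, 0) (by decide)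
  have hz : L2sq (pdz g) ≤ HNsq 2 g := h (0, 0, 1) (by decide)
  have hxy : L2sq (pdx (pdy g)) ≤ HNsq 2 g := h (1, 1, 0) (by decide)
  have hyz : L2sq (pdy (pdz g)) ≤ HNsq 2 g := h (0, 1, 1) (by decide)
  rcases hD with rfl | rfl
  · exact product_estimates_pdx hf hg h0 hy hz hyz hg.L2sq_lap_le_HNsq
  · have key := product_estimates_pdx (K := HNsq 2 g) hf.swapXZ hg.swapXZ
      (hg.decays.L2sq_swapXZ.trans_le h0) (hg.pdy.decays.L2sq_swapXZ.trans_le hy)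
      (hg.pdx.decays.L2sq_swapXZ.trans_le hx)
      (hg.pdx.pdy.decays.L2sq_swapXZ.trans_le (hg.smooth3.pdx_pdy ▸ hxy))
      (by rw [lap_swapXZ, hg.lap_decays.L2sq_swapXZ]; exact hg.L2sq_lap_le_HNsq)
    have e₁ : L2norm (pdx (swapXZ f)) = L2norm (pdz f) := hf.pdz.decays.L2norm_swapXZ
    have e₂ : L2norm (fun x y z => swapXZ f x y z * pdx (swapXZ g) x y z)
        = L2norm fun x y z => f x y z * pdz g x y z :=
      (hf.decays.mul hg.pdz.decays).L2norm_swapXZ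
    have e₃ : L2norm (fun x y z => swapXZ f x y z * swapXZ g x y z)
        = L2norm fun x y z => f x y z * g x y z := (hf.decays.mul hg.decays).L2norm_swapXZ
    have hmul : pdz (fun x y z => f x y z * g x y z)
        = (fun x y z => pdz f x y z * g x y z) + fun x y z => f x y z * pdz g x y z := by
      funext x y z
      exact ((hf.smooth3.hasDerivAt_z x y z).mul (hg.smooth3.hasDerivAt_z x y z)).deriv
    have e₄ : L2norm (pdx fun x y z => swapXZ f x y z * swapXZ g x y z)
        = L2norm (pdz fun x y z => f x y z * g x y z) := by
      have hd : Decays (pdz fun x y z => f x y z * g x y z) := by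
        rw [hmul]
        exact (hf.pdz.decays.mul hg.decays).add (hf.decays.mul hg.pdz.decays)
      exact hd.L2norm_swapXZ
    rwa [e₁, e₂, e₃, e₄, hf.decays.L2norm_swapXZ, lap_swapXZ, hg.lap_decays.L2norm_swapXZ] at key

end
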